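/- Marginal asymptotics for the dependent example (Appendix B, Example 2.5 with d=2 and constant ψ): as x₁→∞, Σ_{x₂=0}^{∞} (x₁^{β₁}+x₂^{β₂})^{−β} ∼ c₁·x₁^{−(1+γ₁)} where c₁=∫_0^∞(1+t^{β₂})^{−β} dt and γ₁:=β₁(β−β₁^{−1}−β₂^{−1}); consequently, if X=(X^{(1)},X^{(2)}) has law P(X=(x₁,x₂))=c₀(x₁^{β₁}+x₂^{β₂})^{−β} on N², then P(X^{(1)}=x₁)∼c₀c₁·x₁^{−(1+γ₁)} as x₁→∞. -/

import Mathlib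

open MeasureTheory Filter

noncomputable section

/-- Left Riemann sums over the half line, of mesh `h`, of an antitone integrable nonnegative
function converge to its integral as `h → 0⁺`. -/
theorem tendsto_mul_tsum_of_antitoneOn {f : ℝ → ℝ} (anti : AntitoneOn f (Set.Ici 0))
    (integrable : IntegrableOn f (Set.Ioi 0)) (nonneg : ∀ t ∈ Set.Ioi (0 : ℝ), 0 ≤ f t) :
    Tendsto (fun h : ℝ => h * ∑' n : ℕ, f (h * n)) (nhdsWithin 0 (Set.Ioi 0))
      (nhds (∫ t in Set.Ioi (0 : ℝ), f t)) := by
  have bounds : ∀ h : ℝ, 0 < h → (∫ t in Set.Ioi (0 : ℝ), f t) ≤ h * ∑' n : ℕ, f (h * n) ∧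
      h * ∑' n : ℕ, f (h * n) ≤ h * f 0 + ∫ t in Set.Ioi (0 : ℝ), f t := by
    intro h hh
    have anti' : AntitoneOn (fun t => f (h * t)) (Set.Ici 0) := fun a ha b hb hab =>
      anti (mul_nonneg hh.le ha) (mul_nonneg hh.le hb) (mul_le_mul_of_nonneg_left hab hh.le)
    have integrable' : IntegrableOn (fun t => f (h * t)) (Set.Ioi 0) := by
      rw [integrableOn_Ioi_comp_mul_left_iff f 0 hh, mul_zero]
      exact integrable
    have nonneg' : ∀ t ∈ Set.Ioi (0 : ℝ), 0 ≤ f (h * t) := fun t ht => nonneg _ (mul_pos hh ht)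
    have integral_eq : h * ∫ t in Set.Ioi (0 : ℝ), f (h * t) = ∫ t in Set.Ioi (0 : ℝ), f t := by
      rw [integral_comp_mul_left_Ioi f 0 hh, mul_zero, smul_eq_mul, mul_inv_cancel_left₀ hh.ne']
    have lower := anti'.integral_le_tsum
      (anti'.summable_of_integrableOn_Ioi_zero integrable' nonneg') nonneg'
    have upper := anti'.tsum_le_integral integrable' nonneg'
    rw [mul_zero] at upper
    rw [← integral_eq, ← mul_add]
    exact ⟨mul_le_mul_of_nonneg_left lower hh.le, mul_le_mul_of_nonneg_left upper hh.le⟩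
  have upper_lim : Tendsto (fun h : ℝ => h * f 0 + ∫ t in Set.Ioi (0 : ℝ), f t)
      (nhdsWithin 0 (Set.Ioi 0)) (nhds (∫ t in Set.Ioi (0 : ℝ), f t)) := by
    refine (Continuous.tendsto' (by fun_prop) 0 _ (by simp)).mono_left nhdsWithin_le_nhds
  refine tendsto_of_tendsto_of_tendsto_of_le_of_le' tendsto_const_nhds upper_lim ?_ ?_
  · filter_upwards [self_mem_nhdsWithin] with h hh using (bounds h hh).1
  · filter_upwards [self_mem_nhdsWithin] with h hh using (bounds h hh).2

theorem antitoneOn_one_add_rpow_rpow_neg {a b : ℝ} (ha : 0 ≤ a) (hb : 0 ≤ b) :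
    AntitoneOn (fun t : ℝ => (1 + t ^ a) ^ (-b)) (Set.Ici 0) := by
  intro s hs t _ hst
  have hs' : 0 ≤ s ^ a := Real.rpow_nonneg hs _
  exact Real.rpow_le_rpow_of_nonpos (by positivity)
    (by gcongr) (neg_nonpos.mpr hb)

theorem integrableOn_one_add_rpow_rpow_neg {a b : ℝ} (ha : 0 < a) (hab : 1 < a * b) :
    IntegrableOn (fun t : ℝ => (1 + t ^ a) ^ (-b)) (Set.Ioi 0) := by
  have hb : 0 < b := pos_of_mul_pos_right (zero_lt_one.trans hab) ha.le
  have anti := antitoneOn_one_add_rpow_rpow_neg ha.le hb.le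
  rw [← Set.Ioc_union_Ioi_eq_Ioi zero_le_one]
  refine IntegrableOn.union ?_ ?_
  · exact ((anti.mono Set.Icc_subset_Ici_self).integrableOn_isCompact isCompact_Icc).mono_set
      Set.Ioc_subset_Icc_self
  · have dominating : IntegrableOn (fun t : ℝ => t ^ (-(a * b))) (Set.Ioi 1) :=
      integrableOn_Ioi_rpow_of_lt (by linarith) zero_lt_one
    refine Integrable.mono' dominating
      (((measurable_id.pow_const a).const_add 1).pow_const (-b)).aestronglyMeasurable ?_
    filter_upwards [ae_restrict_mem measurableSet_Ioi] with t ht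
    have ht0 : 0 < t := zero_lt_one.trans ht
    have hta : 0 < t ^ a := Real.rpow_pos_of_pos ht0 a
    rw [Real.norm_of_nonneg (by positivity), ← mul_neg, Real.rpow_mul ht0.le]
    exact Real.rpow_le_rpow_of_nonpos hta (by linarith) (by linarith)

theorem integral_one_add_rpow_rpow_neg_pos {a b : ℝ} (ha : 0 < a) (hab : 1 < a * b) :
    0 < ∫ t in Set.Ioi (0 : ℝ), (1 + t ^ a) ^ (-b) := by
  have pos : ∀ t ∈ Set.Ioi (0 : ℝ), 0 < (1 + t ^ a) ^ (-b) := fun t ht => by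
    have := Real.rpow_pos_of_pos ht a
    positivity
  refine (setIntegral_pos_iff_support_of_nonneg_ae ?_
    (integrableOn_one_add_rpow_rpow_neg ha hab)).mpr ?_
  · filter_upwards [ae_restrict_mem measurableSet_Ioi] with t ht using (pos t ht).le
  · have subset : Set.Ioi 0 ⊆ Function.support fun t : ℝ => (1 + t ^ a) ^ (-b) :=
      fun t ht => (pos t ht).ne'
    rw [Set.inter_eq_self_of_subset_right subset]
    simp

/-- The scaling identity for the slice sums of `(x ^ c + y ^ a) ^ (-b)`. -/
theorem tsum_rpow_add_rpow_rpow_neg {c a b x : ℝ} (ha : 0 < a) (hx : 0 < x) :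
    ∑' n : ℕ, (x ^ c + (n : ℝ) ^ a) ^ (-b)
      = x ^ (-(c * b)) * ∑' n : ℕ, (1 + (x ^ (-(c / a)) * n) ^ a) ^ (-b) := by
  rw [← tsum_mul_left]
  congr 1 with n
  have hn : (0 : ℝ) ≤ (n : ℝ) ^ a := by positivity
  have hxa : 0 < x ^ c := Real.rpow_pos_of_pos hx c
  have hscale : (x ^ (-(c / a)) * n) ^ a = (x ^ c)⁻¹ * (n : ℝ) ^ a := by
    rw [Real.mul_rpow (by positivity) (by positivity), ← Real.rpow_mul hx.le, neg_mul,
      div_mul_cancel₀ _ ha.ne', Real.rpow_neg hx.le]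
  rw [hscale, ← mul_neg, Real.rpow_mul hx.le, ← Real.mul_rpow hxa.le (by positivity), mul_add,
    mul_one, mul_inv_cancel_left₀ hxa.ne']

/-- The law of the first coordinate of a pair of natural numbers is obtained by summing the
joint law over the second coordinate. -/
theorem toReal_measure_fst_eq_tsum {Ω : Type*} [MeasurableSpace Ω] (P : Measure Ω)
    [IsFiniteMeasure P] {X : Ω → ℕ × ℕ} (hX : Measurable X) (m : ℕ) :
    (P {ω | (X ω).1 = m}).toReal = ∑' n : ℕ, (P {ω | X ω = (m, n)}).toReal := by
  rw [← ENNReal.tsum_toReal_eq fun n => measure_ne_top P _, ← measure_iUnion]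
  · congr 2
    ext ω
    simp [Prod.ext_iff]
  · intro i j hij
    refine Set.disjoint_left.mpr fun ω hi hj => hij ?_
    exact (Prod.ext_iff.mp ((Set.mem_ofPred.mp hi).symm.trans hj)).2
  · exact fun n => hX (measurableSet_singleton (m, n))

/-- **Appendix B / Example 2.5** (marginal asymptotics for the dependent example, with
`d = 2` and constant `ψ`). For `β₁, β₂ > 0` and `β > β₁⁻¹ + β₂⁻¹`, as `x₁ → ∞`,
`∑_{x₂ ≥ 0} (x₁^{β₁} + x₂^{β₂})^{-β} ∼ c₁ x₁^{-(1+γ₁)}` where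
`c₁ = ∫_0^∞ (1 + t^{β₂})^{-β} dt` and `γ₁ = β₁(β - β₁⁻¹ - β₂⁻¹)`; consequently, if
`X = (X⁽¹⁾, X⁽²⁾)` has law `P(X = (x₁,x₂)) = c₀ (x₁^{β₁} + x₂^{β₂})^{-β}` on `ℕ²`, then
`P(X⁽¹⁾ = x₁) ∼ c₀ c₁ x₁^{-(1+γ₁)}` as `x₁ → ∞`. -/
theorem dependent_example_marginal
    (β₁ β₂ β : ℝ) (hβ₁ : 0 < β₁) (hβ₂ : 0 < β₂) (hβ : β₁⁻¹ + β₂⁻¹ < β)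
    (γ₁ : ℝ) (hγ₁ : γ₁ = β₁ * (β - β₁⁻¹ - β₂⁻¹))
    (c₁ : ℝ) (hc₁ : c₁ = ∫ t in Set.Ioi (0 : ℝ), (1 + t ^ β₂) ^ (-β)) :
    Tendsto (fun x₁ : ℕ =>
        (∑' x₂ : ℕ, ((x₁ : ℝ) ^ β₁ + (x₂ : ℝ) ^ β₂) ^ (-β))
          / (c₁ * (x₁ : ℝ) ^ (-(1 + γ₁)))) atTop (nhds 1)
    ∧ ∀ {Ω : Type} [MeasurableSpace Ω] (P : Measure Ω), IsProbabilityMeasure P →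
        ∀ (X : Ω → ℕ × ℕ), Measurable X → ∀ c₀ : ℝ, 0 < c₀ →
        (∀ x : ℕ × ℕ, (P {ω | X ω = x}).toReal
            = c₀ * ((x.1 : ℝ) ^ β₁ + (x.2 : ℝ) ^ β₂) ^ (-β)) →
        Tendsto (fun x₁ : ℕ =>
            (P {ω | (X ω).1 = x₁}).toReal / (c₀ * c₁ * (x₁ : ℝ) ^ (-(1 + γ₁))))
          atTop (nhds 1) := by
  have hb : 1 < β₂ * β := by
    have : β₂⁻¹ < β := by linarith [inv_pos.mpr hβ₁]
    simpa [hβ₂.ne'] using mul_lt_mul_of_pos_left this hβ₂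
  have hβ0 : 0 < β := by linarith [inv_pos.mpr hβ₁, inv_pos.mpr hβ₂]
  have hc₁pos : 0 < c₁ := hc₁ ▸ integral_one_add_rpow_rpow_neg_pos hβ₂ hb
  have mesh : Tendsto (fun x : ℕ => (x : ℝ) ^ (-(β₁ / β₂))) atTop
      (nhdsWithin 0 (Set.Ioi 0)) := by
    refine tendsto_nhdsWithin_iff.mpr
      ⟨(tendsto_rpow_neg_atTop (div_pos hβ₁ hβ₂)).comp tendsto_natCast_atTop_atTop, ?_⟩
    filter_upwards [eventually_gt_atTop 0] with x hx
    exact Real.rpow_pos_of_pos (Nat.cast_pos.mpr hx) _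
  have riemann := (tendsto_mul_tsum_of_antitoneOn
    (antitoneOn_one_add_rpow_rpow_neg hβ₂.le hβ0.le)
    (integrableOn_one_add_rpow_rpow_neg hβ₂ hb)
    (fun t ht => by have := Real.rpow_pos_of_pos ht β₂; positivity)).comp mesh
  rw [← hc₁] at riemann
  have slice : Tendsto (fun x₁ : ℕ =>
      (∑' x₂ : ℕ, ((x₁ : ℝ) ^ β₁ + (x₂ : ℝ) ^ β₂) ^ (-β))
        / (c₁ * (x₁ : ℝ) ^ (-(1 + γ₁)))) atTop (nhds 1) := by
    have quotient := riemann.div_const c₁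
    rw [div_self hc₁pos.ne'] at quotient
    refine quotient.congr' ?_
    filter_upwards [eventually_gt_atTop 0] with x hx
    have hx' : (0 : ℝ) < x := Nat.cast_pos.mpr hx
    have exponent : -(β₁ * β) = -(1 + γ₁) + -(β₁ / β₂) := by
      rw [hγ₁]
      field_simp
      ring
    have hpow : (x : ℝ) ^ (-(1 + γ₁)) ≠ 0 := (Real.rpow_pos_of_pos hx' _).ne'
    rw [tsum_rpow_add_rpow_rpow_neg hβ₂ hx', exponent, Real.rpow_add hx', Function.comp_apply]
    field_simp
  refine ⟨slice, ?_⟩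
  intro Ω _ P _ X hX c₀ hc₀ law
  refine slice.congr fun m => ?_
  simp_rw [toReal_measure_fst_eq_tsum P hX, law, tsum_mul_left]
  rw [mul_assoc, mul_div_mul_left _ _ hc₀.ne']
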